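/- Let E be a real inner product space and let u : (0, ∞) × ℝ → E, (r, t) ↦ u(r, t), be twice continuously differentiable. Define e = (1/2)(‖∂_r u‖² + ‖∂_t u‖²) and m = ⟨∂_r u, ∂_t u⟩. Assume the orthogonality condition ⟨∂²_{tt} u − ∂²_{rr} u − r^{−1} ∂_r u, ∂_r u⟩ = 0 holds at every point (r, t). Then at every point (r, t): ∂_t(r²·m) = ∂_r(r²·e) − r·‖∂_t u‖². -/

import Mathlib

open scoped RealInnerProductSpace

/-- The partial derivative `∂_r u` of `u = u(r,t)`. -/
noncomputable def pr {E : Type*} [NormedAddCommGroup E] [NormedSpace ℝ E]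
    (u : ℝ × ℝ → E) (p : ℝ × ℝ) : E :=
  fderiv ℝ u p (1, 0)

/-- The partial derivative `∂_t u` of `u = u(r,t)`. -/
noncomputable def pt {E : Type*} [NormedAddCommGroup E] [NormedSpace ℝ E]
    (u : ℝ × ℝ → E) (p : ℝ × ℝ) : E :=
  fderiv ℝ u p (0, 1)

/-- The energy density `e = (1/2)(‖∂_r u‖² + ‖∂_t u‖²)`. -/
noncomputable def eDen {E : Type*} [NormedAddCommGroup E] [InnerProductSpace ℝ E]
    (u : ℝ × ℝ → E) (p : ℝ × ℝ) : ℝ :=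
  (‖pr u p‖ ^ 2 + ‖pt u p‖ ^ 2) / 2

/-- The momentum density `m = ⟨∂_r u, ∂_t u⟩`. -/
noncomputable def mDen {E : Type*} [NormedAddCommGroup E] [InnerProductSpace ℝ E]
    (u : ℝ × ℝ → E) (p : ℝ × ℝ) : ℝ :=
  ⟪pr u p, pt u p⟫

/-- The directional derivative of a `C²` function is differentiable, with derivative given by the second derivative of `u`. -/
theorem hasFDerivAt_fderiv_apply {F E : Type*} [NormedAddCommGroup F] [NormedSpace ℝ F]
    [NormedAddCommGroup E] [NormedSpace ℝ E] {u : F → E} {p : F}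
    (hu : ContDiffAt ℝ 2 u p) (v : F) :
    HasFDerivAt (fun q => fderiv ℝ u q v) ((fderiv ℝ (fderiv ℝ u) p).flip v) p := by
  have h : DifferentiableAt ℝ (fderiv ℝ u) p :=
    (hu.fderiv_right (m := 1) (by norm_num)).differentiableAt (by norm_num)
  simpa using h.hasFDerivAt.clm_apply (hasFDerivAt_const v p)

/-- Mixed partial derivatives of a `C²` function commute. -/
theorem fderiv_pr_eq_fderiv_pt {E : Type*} [NormedAddCommGroup E] [NormedSpace ℝ E]
    {u : ℝ × ℝ → E} {p : ℝ × ℝ} (hu : ContDiffAt ℝ 2 u p) :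
    fderiv ℝ (pr u) p (0, 1) = fderiv ℝ (pt u) p (1, 0) := by
  have hr : fderiv ℝ (pr u) p = _ := (hasFDerivAt_fderiv_apply hu (1, 0)).fderiv
  have ht : fderiv ℝ (pt u) p = _ := (hasFDerivAt_fderiv_apply hu (0, 1)).fderiv
  rw [hr, ht]
  exact (hu.isSymmSndFDerivAt (by simp)).eq (0, 1) (1, 0)

/-- The virial identity for (the radial profile of) a wave map: if `u` is `C²` on
`(0,∞) × ℝ` and the wave operator `∂²_tt u - ∂²_rr u - r⁻¹ ∂_r u` is orthogonal to
`∂_r u`, then `∂_t(r² m) = ∂_r(r² e) - r ‖∂_t u‖²`. -/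
theorem stmt_12 {E : Type*} [NormedAddCommGroup E] [InnerProductSpace ℝ E]
    (u : ℝ × ℝ → E)
    (hu : ContDiffOn ℝ 2 u {p : ℝ × ℝ | 0 < p.1})
    (horth : ∀ p : ℝ × ℝ, 0 < p.1 →
      ⟪fderiv ℝ (pt u) p (0, 1) - fderiv ℝ (pr u) p (1, 0) - p.1⁻¹ • pr u p,
        pr u p⟫ = 0) :
    ∀ p : ℝ × ℝ, 0 < p.1 →
      deriv (fun t => p.1 ^ 2 * mDen u (p.1, t)) p.2 =
        deriv (fun r => r ^ 2 * eDen u (r, p.2)) p.1 - p.1 * ‖pt u p‖ ^ 2 := by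
  intro p hp
  have hc : ContDiffAt ℝ 2 u p :=
    hu.contDiffAt ((isOpen_lt continuous_const continuous_fst).mem_nhds hp)
  have hr : HasFDerivAt (pr u) (fderiv ℝ (pr u) p) p :=
    (hasFDerivAt_fderiv_apply hc (1, 0)).differentiableAt.hasFDerivAt
  have ht : HasFDerivAt (pt u) (fderiv ℝ (pt u) p) p :=
    (hasFDerivAt_fderiv_apply hc (0, 1)).differentiableAt.hasFDerivAt
  have hline_t : HasDerivAt (fun t : ℝ => (p.1, t)) ((0 : ℝ), (1 : ℝ)) p.2 :=
    (hasDerivAt_const p.2 p.1).prodMk (hasDerivAt_id p.2)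
  have hline_r : HasDerivAt (fun r : ℝ => (r, p.2)) ((1 : ℝ), (0 : ℝ)) p.1 :=
    (hasDerivAt_id p.1).prodMk (hasDerivAt_const p.1 p.2)
  have hrt : HasDerivAt (fun t => pr u (p.1, t)) (fderiv ℝ (pr u) p (0, 1)) p.2 :=
    HasFDerivAt.comp_hasDerivAt (l := pr u) (f := fun t => (p.1, t)) p.2 hr hline_t
  have htt : HasDerivAt (fun t => pt u (p.1, t)) (fderiv ℝ (pt u) p (0, 1)) p.2 :=
    HasFDerivAt.comp_hasDerivAt (l := pt u) (f := fun t => (p.1, t)) p.2 ht hline_t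
  have hrr : HasDerivAt (fun r => pr u (r, p.2)) (fderiv ℝ (pr u) p (1, 0)) p.1 :=
    HasFDerivAt.comp_hasDerivAt (l := pr u) (f := fun r => (r, p.2)) p.1 hr hline_r
  have htr : HasDerivAt (fun r => pt u (r, p.2)) (fderiv ℝ (pt u) p (1, 0)) p.1 :=
    HasFDerivAt.comp_hasDerivAt (l := pt u) (f := fun r => (r, p.2)) p.1 ht hline_r
  have hm : HasDerivAt (fun t => p.1 ^ 2 * mDen u (p.1, t)) _ p.2 :=
    (hrt.inner ℝ htt).const_mul (p.1 ^ 2)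
  have he : HasDerivAt (fun r => r ^ 2 * eDen u (r, p.2)) _ p.1 :=
    (hasDerivAt_pow 2 p.1).mul ((hrr.norm_sq.add htr.norm_sq).div_const 2)
  have h := horth p hp
  rw [hm.deriv, he.deriv, fderiv_pr_eq_fderiv_pt hc]
  simp only [inner_sub_left, real_inner_smul_left, real_inner_self_eq_norm_sq] at h
  simp only [Prod.mk.eta, eDen]
  rw [real_inner_comm (fderiv ℝ (pt u) p (0, 1)) (pr u p)]
  rw [real_inner_comm (fderiv ℝ (pr u) p (1, 0)) (pr u p)]
  rw [real_inner_comm (fderiv ℝ (pt u) p (1, 0)) (pt u p)]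
  field_simp at h ⊢
  linear_combination 2 * p.1 * h
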